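/- For every fixed integer k >= 0 and every integer n >= 0, the equality d(n+1,k) = t(n+1,k) - d(n,k) + 2 * (sum over i = 0,...,n of binomial(n,i) * z(n-i) * d(i,k)) holds. Equivalently, the exponential generating function A_k(x) = sum over n >= 0 of d(n,k) x^n / n! satisfies the differential equation A_k'(x) = 2 A_k(x) Z(x) - A_k(x) + R_k'(x) with A_k(0) = 0, where Z(x) = sum over n >= 0 of z(n) x^n/n! and R_k(x) = sum over n >= 0 of t(n,k) x^n / n!. -/

import Mathlib

namespace BalancedTrees

/-- Plane binary trees with vertices labeled by natural numbers;
`nil` is the empty tree, and each child of a vertex is designated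
as a left child or a right child. -/
inductive BT where
  | nil : BT
  | node (label : ℕ) (l r : BT) : BT
deriving DecidableEq

namespace BT

/-- `balRank t = some k` if and only if the root of `t` is a balanced vertex of
rank `k`, i.e. every descending path from the root to a leaf has length `k`. -/
def balRank : BT → Option ℕ
  | .nil => none
  | .node _ .nil .nil => some 0
  | .node _ .nil (.node b rl rr) => (balRank (BT.node b rl rr)).map (· + 1)
  | .node _ (.node a ll lr) .nil => (balRank (BT.node a ll lr)).map (· + 1)
  | .node _ (.node a ll lr) (.node b rl rr) =>
      match balRank (BT.node a ll lr), balRank (BT.node b rl rr) with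
      | some i, some j => if i = j then some (i + 1) else none
      | _, _ => none

/-- The number of balanced vertices of rank `k` in the tree `t`. -/
def countBal (k : ℕ) : BT → ℕ
  | .nil => 0
  | .node v l r =>
      countBal k l + countBal k r +
        (if balRank (BT.node v l r) = some k then 1 else 0)

/-- The number of balanced vertices (of any rank) in the tree `t`. -/
def countBalAll : BT → ℕ
  | .nil => 0
  | .node v l r =>
      countBalAll l + countBalAll r +
        (if (balRank (BT.node v l r)).isSome then 1 else 0)

/-- Auxiliary, fuelled version of `treeOf`. -/
def treeOfAux : ℕ → List ℕ → BT
  | 0, _ => .nil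
  | _ + 1, [] => .nil
  | fuel + 1, l =>
      let m := l.foldr max 0
      BT.node m (treeOfAux fuel (l.takeWhile (· != m)))
                (treeOfAux fuel ((l.dropWhile (· != m)).tail))

/-- The decreasing binary tree `T(π)` of a sequence `π` of distinct labels:
the root is the maximum entry, and its left (resp. right) subtree is built
recursively from the part of the sequence to the left (resp. right) of the
maximum. This is a bijection between permutations of `{1,…,n}` and
decreasing binary trees on `{1,…,n}`. -/
def treeOf (l : List ℕ) : BT := treeOfAux l.length l

/-- Canonical form for non-plane 1-2 trees (as represented by plane trees):
an only child is stored as a left child, and of two (unordered) children the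
one with the larger label is stored on the left. Decreasing binary trees in
canonical form are in bijection with non-plane 1-2 trees. -/
def canonNP : BT → Bool
  | .nil => true
  | .node _ l r =>
      canonNP l && canonNP r &&
        (match l, r with
         | .nil, .nil => true
         | .node _ _ _, .nil => true
         | .nil, .node _ _ _ => false
         | .node a _ _, .node b _ _ => decide (b < a))

/-- Canonical form for plane 1-2 trees: an only child is stored as a left
child (an only child carries no left/right designation), while two children
remain ordered. Decreasing binary trees in canonical form are in bijection
with plane 1-2 trees. -/
def canonP : BT → Bool
  | .nil => true
  | .node _ l r =>
      canonP l && canonP r &&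
        (match l, r with
         | .nil, .node _ _ _ => false
         | _, _ => true)

end BT

open BT

/-- The list of all permutations of `{1,…,n}`, each written as a list. -/
def perms (n : ℕ) : List (List ℕ) := (List.range' 1 n).permutations

/-- `a n k`: the total number of balanced vertices of rank `k` over all
decreasing binary trees on `{1,…,n}`. -/
def a (n k : ℕ) : ℕ := ((perms n).map fun l => countBal k (treeOf l)).sum

/-- `r n k`: the number of decreasing binary trees on `{1,…,n}` whose root is
balanced of rank `k`. -/
def r (n k : ℕ) : ℕ :=
  ((perms n).filter fun l => decide (balRank (treeOf l) = some k)).length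

/-- `p n k`: the probability that the root of a uniformly random decreasing
binary tree on `{1,…,n}` is balanced of rank `k`; by convention `p 0 k = 1`. -/
def p (n k : ℕ) : ℚ := if n = 0 then 1 else (r n k : ℚ) / (Nat.factorial n : ℚ)

/-- The number of decreasing binary trees on `{1,…,n}` whose root is balanced. -/
def rootBal (n : ℕ) : ℕ :=
  ((perms n).filter fun l => (balRank (treeOf l)).isSome).length

/-- `proot n`: the probability that the root of a uniformly random decreasing
binary tree on `{1,…,n}` is balanced. -/
def proot (n : ℕ) : ℚ := (rootBal n : ℚ) / (Nat.factorial n : ℚ)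

/-- The total number of balanced vertices over all decreasing binary trees
on `{1,…,n}`. -/
def totalBal (n : ℕ) : ℕ := ((perms n).map fun l => countBalAll (treeOf l)).sum

/-- `Pbal n`: the probability that a vertex chosen uniformly at random from
the `n * n!` vertices of all decreasing binary trees on `{1,…,n}` is balanced. -/
def Pbal (n : ℕ) : ℚ := (totalBal n : ℚ) / ((n : ℚ) * (Nat.factorial n : ℚ))

/-- Permutations whose decreasing binary tree is a canonical representative
of a non-plane 1-2 tree; these are in bijection with non-plane 1-2 trees
on `{1,…,n}`. -/
def npPerms (n : ℕ) : List (List ℕ) := (perms n).filter fun l => canonNP (treeOf l)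

/-- `E n`: the number of non-plane 1-2 trees on `{1,…,n}` (the Euler number). -/
def E (n : ℕ) : ℕ := (npPerms n).length

/-- `b n k`: the total number of balanced vertices of rank `k` over all
non-plane 1-2 trees on `{1,…,n}`. -/
def b (n k : ℕ) : ℕ := ((npPerms n).map fun l => countBal k (treeOf l)).sum

/-- `s n k`: the number of non-plane 1-2 trees on `{1,…,n}` whose root is
balanced of rank `k`. -/
def s (n k : ℕ) : ℕ :=
  ((npPerms n).filter fun l => decide (balRank (treeOf l) = some k)).length

/-- Permutations whose decreasing binary tree is a canonical representative
of a plane 1-2 tree; these are in bijection with plane 1-2 trees on `{1,…,n}`. -/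
def pPerms (n : ℕ) : List (List ℕ) := (perms n).filter fun l => canonP (treeOf l)

/-- `z n`: the number of plane 1-2 trees on `{1,…,n}`. -/
def z (n : ℕ) : ℕ := (pPerms n).length

/-- `d n k`: the total number of balanced vertices of rank `k` over all
plane 1-2 trees on `{1,…,n}`. -/
def d (n k : ℕ) : ℕ := ((pPerms n).map fun l => countBal k (treeOf l)).sum

/-- `t n k`: the number of plane 1-2 trees on `{1,…,n}` whose root is
balanced of rank `k`. -/
def t (n k : ℕ) : ℕ :=
  ((pPerms n).filter fun l => decide (balRank (treeOf l) = some k)).length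

end BalancedTrees

open BalancedTrees

namespace BalancedTrees

open BT

/-- The tree obtained by replacing all labels by `0`. -/
def BT.shape : BT → BT
  | .nil => .nil
  | .node _ l r => .node 0 l.shape r.shape

theorem BT.shape_shape (u : BT) : u.shape.shape = u.shape := by
  induction u with
  | nil => rfl
  | node v l r hl hr => simp [BT.shape, hl, hr]

theorem BT.canonP_shape (u : BT) : canonP u.shape = canonP u := by
  induction u with
  | nil => rfl
  | node v l r hl hr =>
    cases l <;> cases r <;> simp_all [BT.shape, canonP]

theorem BT.balRank_shape (u : BT) : balRank u.shape = balRank u := by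
  induction u with
  | nil => rfl
  | node v l r hl hr =>
    cases l <;> cases r <;> simp_all [BT.shape, balRank]

theorem BT.countBal_shape (k : ℕ) (u : BT) : countBal k u.shape = countBal k u := by
  induction u with
  | nil => rfl
  | node v l r hl hr =>
    have h := BT.balRank_shape (.node v l r)
    simp only [BT.shape] at h
    simp only [BT.shape, countBal, hl, hr, h]

theorem BT.treeOfAux_append_cons {m : ℕ} {l₁ l₂ : List ℕ} (fuel : ℕ)
    (h₁ : ∀ x ∈ l₁, x < m) (h₂ : ∀ x ∈ l₂, x < m) :
    treeOfAux (fuel + 1) (l₁ ++ m :: l₂) =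
      .node m (treeOfAux fuel l₁) (treeOfAux fuel l₂) := by
  have hle : ∀ l : List ℕ, (∀ x ∈ l, x < m) → l.foldr max 0 ≤ m := by
    intro l hl
    induction l with
    | nil => simp
    | cons a l ih =>
      simp only [List.mem_cons, forall_eq_or_imp] at hl
      exact max_le hl.1.le (ih hl.2)
  have hmax : (l₁ ++ m :: l₂).foldr max 0 = m := by
    have hm : (m :: l₂).foldr max 0 = m := max_eq_left (hle l₂ h₂)
    rw [List.foldr_append, hm]
    clear hm
    induction l₁ with
    | nil => rfl
    | cons a l ih =>
      simp only [List.mem_cons, forall_eq_or_imp] at h₁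
      rw [List.foldr_cons, ih h₁.2]
      exact max_eq_right h₁.1.le
  have hne : ∀ x ∈ l₁, (x != m) = true := fun x hx => by simpa using (h₁ x hx).ne
  have htake : (l₁ ++ m :: l₂).takeWhile (· != m) = l₁ := by
    rw [List.takeWhile_append_of_pos hne]; simp
  have hdrop : (l₁ ++ m :: l₂).dropWhile (· != m) = m :: l₂ := by
    rw [List.dropWhile_append_of_pos hne]; simp
  rw [treeOfAux]
  · simp only [hmax, htake, hdrop, List.tail_cons]
  · simp

theorem exists_eq_append_cons_lt {l : List ℕ} (hl : l.Nodup) (hne : l ≠ []) :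
    ∃ l₁ m l₂, l = l₁ ++ m :: l₂ ∧ (∀ x ∈ l₁, x < m) ∧ ∀ x ∈ l₂, x < m := by
  obtain ⟨m, hm, hmax⟩ := l.toFinset.exists_max_image id
    (List.toFinset_nonempty_iff l |>.2 hne)
  obtain ⟨l₁, l₂, rfl⟩ := List.append_of_mem (List.mem_toFinset.1 hm)
  refine ⟨l₁, m, l₂, rfl, fun x hx => ?_, fun x hx => ?_⟩
  · exact lt_of_le_of_ne (hmax x (by simp [hx])) (by grind)
  · exact lt_of_le_of_ne (hmax x (by simp [hx])) (by grind)

theorem BT.treeOfAux_eq_treeOf (fuel : ℕ) {l : List ℕ} (hl : l.Nodup) (h : l.length ≤ fuel) :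
    treeOfAux fuel l = treeOf l := by
  suffices H : ∀ f g (l : List ℕ), l.Nodup → l.length ≤ f → l.length ≤ g →
      treeOfAux f l = treeOfAux g l from H _ _ l hl h le_rfl
  intro f
  induction f with
  | zero =>
    intro g l _ hf _
    obtain rfl : l = [] := List.length_eq_zero_iff.1 (by omega)
    cases g <;> rfl
  | succ f ih =>
    intro g l hl hf hg
    rcases eq_or_ne l [] with rfl | hne
    · cases g <;> rfl
    · obtain ⟨l₁, m, l₂, rfl, h₁, h₂⟩ := exists_eq_append_cons_lt hl hne
      simp only [List.length_append, List.length_cons] at hf hg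
      obtain ⟨g, rfl⟩ : ∃ g', g = g' + 1 := ⟨g - 1, by omega⟩
      have hl₁ : l₁.Nodup := by grind
      have hl₂ : l₂.Nodup := by grind
      rw [BT.treeOfAux_append_cons f h₁ h₂, BT.treeOfAux_append_cons g h₁ h₂,
        ih g l₁ hl₁ (by omega) (by omega), ih g l₂ hl₂ (by omega) (by omega)]

theorem BT.treeOf_append_cons {m : ℕ} {l₁ l₂ : List ℕ} (hl₁ : l₁.Nodup) (hl₂ : l₂.Nodup)
    (h₁ : ∀ x ∈ l₁, x < m) (h₂ : ∀ x ∈ l₂, x < m) :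
    treeOf (l₁ ++ m :: l₂) = .node m (treeOf l₁) (treeOf l₂) := by
  have hlen : (l₁ ++ m :: l₂).length = (l₁.length + l₂.length) + 1 := by simp; omega
  rw [treeOf, hlen, BT.treeOfAux_append_cons _ h₁ h₂,
    BT.treeOfAux_eq_treeOf _ hl₁ (by omega), BT.treeOfAux_eq_treeOf _ hl₂ (by omega)]

/-- The arrangements of a finite set as a list without repetitions. -/
noncomputable def arrangements (S : Finset ℕ) : Finset (List ℕ) := S.toList.permutations.toFinset

theorem mem_arrangements {S : Finset ℕ} {l : List ℕ} :
    l ∈ arrangements S ↔ l.Nodup ∧ l.toFinset = S := by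
  rw [arrangements, List.mem_toFinset, List.mem_permutations]
  constructor
  · intro h
    exact ⟨h.nodup_iff.2 S.nodup_toList, by rw [List.toFinset_eq_of_perm _ _ h, S.toList_toFinset]⟩
  · rintro ⟨hl, rfl⟩
    exact (List.toFinset_toList hl).symm

theorem arrangements_empty : arrangements ∅ = {[]} := by
  simp [arrangements]

theorem sum_arrangements_insert {S : Finset ℕ} {m : ℕ} (hm : m ∉ S) (g : List ℕ → ℕ) :
    ∑ l ∈ arrangements (insert m S), g l =
      ∑ T ∈ S.powerset, ∑ l₁ ∈ arrangements T, ∑ l₂ ∈ arrangements (S \ T),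
        g (l₁ ++ m :: l₂) := by
  simp_rw [← Finset.sum_product']
  rw [Finset.sum_sigma']
  symm
  refine Finset.sum_bij (fun x _ => x.2.1 ++ m :: x.2.2) ?_ ?_ ?_ ?_
  · rintro ⟨T, l₁, l₂⟩ h
    simp only [Finset.mem_sigma, Finset.mem_powerset, Finset.mem_product, mem_arrangements] at h
    obtain ⟨hT, ⟨hl₁, rfl⟩, hl₂, h₂⟩ := h
    have hmem : ∀ x, x ∈ l₂ ↔ x ∈ S ∧ x ∉ l₁ := fun x => by
      rw [← List.mem_toFinset, h₂]; simp
    have hsub : ∀ x ∈ l₁, x ∈ S := fun x hx => hT (List.mem_toFinset.2 hx)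
    rw [mem_arrangements]
    constructor
    · grind
    · ext x
      simp only [List.mem_toFinset, List.mem_append, List.mem_cons, Finset.mem_insert]
      grind
  · rintro ⟨T, l₁, l₂⟩ h ⟨T', l₁', l₂'⟩ h' heq
    simp only [Finset.mem_sigma, Finset.mem_powerset, Finset.mem_product, mem_arrangements] at h h'
    obtain ⟨hT, ⟨hl₁, rfl⟩, hl₂, h₂⟩ := h
    obtain ⟨hT', ⟨hl₁', rfl⟩, hl₂', h₂'⟩ := h'
    have hm₁ : m ∉ l₁ := fun h => hm (hT (List.mem_toFinset.2 h))
    have hm₁' : m ∉ l₁' := fun h => hm (hT' (List.mem_toFinset.2 h))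
    have hm₂ : m ∉ l₂ := fun h => hm (Finset.mem_sdiff.1 (h₂ ▸ List.mem_toFinset.2 h)).1
    obtain ⟨rfl, -, rfl⟩ := (List.append_cons_inj_of_notMem hm₁ hm₂).1 heq
    rfl
  · intro l hl
    rw [mem_arrangements] at hl
    obtain ⟨hl, hS⟩ := hl
    have hmem : ∀ x, x ∈ l ↔ x = m ∨ x ∈ S := fun x => by
      rw [← List.mem_toFinset, hS, Finset.mem_insert]
    obtain ⟨l₁, l₂, rfl⟩ := List.append_of_mem ((hmem m).2 (Or.inl rfl))
    refine ⟨⟨l₁.toFinset, l₁, l₂⟩, ?_, rfl⟩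
    simp only [Finset.mem_sigma, Finset.mem_powerset, Finset.mem_product, mem_arrangements]
    refine ⟨fun x hx => ?_, ⟨by grind, trivial⟩, by grind, ?_⟩
    · have := hmem x
      rw [List.mem_toFinset] at hx
      grind
    · ext x
      have := hmem x
      simp only [List.mem_toFinset, Finset.mem_sdiff]
      grind
  · intros
    rfl

theorem sum_arrangements_insert_treeOf {S : Finset ℕ} {m : ℕ} (hm : ∀ x ∈ S, x < m)
    (f : BT → ℕ) :
    ∑ l ∈ arrangements (insert m S), f (treeOf l) =
      ∑ T ∈ S.powerset, ∑ l₁ ∈ arrangements T, ∑ l₂ ∈ arrangements (S \ T),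
        f (.node m (treeOf l₁) (treeOf l₂)) := by
  rw [sum_arrangements_insert (fun h => (hm m h).false)]
  refine Finset.sum_congr rfl fun T hT => Finset.sum_congr rfl fun l₁ h₁ =>
    Finset.sum_congr rfl fun l₂ h₂ => ?_
  rw [mem_arrangements] at h₁ h₂
  rw [BT.treeOf_append_cons h₁.1 h₂.1]
  · intro x hx
    exact hm x (Finset.mem_powerset.1 hT (h₁.2 ▸ List.mem_toFinset.2 hx))
  · intro x hx
    exact hm x (Finset.mem_sdiff.1 (h₂.2 ▸ List.mem_toFinset.2 hx)).1

theorem BT.apply_node_shape {f : BT → ℕ} (hf : ∀ u, f u.shape = f u) (v : ℕ) (l r : BT) :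
    f (.node 0 l.shape r.shape) = f (.node v l r) := hf (.node v l r)

/-- Label-independent sums over the trees on `S` depend only on the size of `S`. -/
theorem sum_arrangements_eq_of_card {f : BT → ℕ} (hf : ∀ u, f u.shape = f u) {S S' : Finset ℕ}
    (h : S.card = S'.card) :
    ∑ l ∈ arrangements S, f (treeOf l) = ∑ l ∈ arrangements S', f (treeOf l) := by
  suffices H : ∀ n, ∀ S : Finset ℕ, S.card = n → ∀ f : BT → ℕ, (∀ u, f u.shape = f u) →
      ∑ l ∈ arrangements S, f (treeOf l) = ∑ l ∈ arrangements (Finset.range n), f (treeOf l) by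
    rw [H _ S h f hf, H _ S' rfl f hf]
  intro n
  induction n using Nat.strong_induction_on with
  | _ n ih =>
  rcases n with _ | n
  · intro S hS f _
    rw [Finset.card_eq_zero.1 hS, Finset.range_zero]
  · have key : ∀ (S : Finset ℕ) (m : ℕ), (∀ x ∈ S, x < m) → S.card = n →
        ∀ f : BT → ℕ, (∀ u, f u.shape = f u) →
        ∑ l ∈ arrangements (insert m S), f (treeOf l) =
          ∑ j ∈ Finset.range (n + 1), n.choose j •
            ∑ l₁ ∈ arrangements (Finset.range j), ∑ l₂ ∈ arrangements (Finset.range (n - j)),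
              f (.node 0 (treeOf l₁) (treeOf l₂)) := by
      intro S m hm hS f hf
      rw [sum_arrangements_insert_treeOf hm, ← hS]
      rw [← Finset.sum_powerset_apply_card (fun j => ∑ l₁ ∈ arrangements (Finset.range j),
        ∑ l₂ ∈ arrangements (Finset.range (S.card - j)), f (.node 0 (treeOf l₁) (treeOf l₂)))]
      refine Finset.sum_congr rfl fun T hT => ?_
      rw [Finset.mem_powerset] at hT
      have hTc := Finset.card_le_card hT
      calc _ = ∑ l₁ ∈ arrangements T, ∑ l₂ ∈ arrangements (Finset.range (S.card - T.card)),
              f (.node m (treeOf l₁) (treeOf l₂)) := by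
            refine Finset.sum_congr rfl fun l₁ _ => ?_
            refine ih (S.card - T.card) (by omega) _ (Finset.card_sdiff_of_subset hT)
              (fun u => f (.node m (treeOf l₁) u)) fun u => ?_
            simp only [← BT.apply_node_shape hf m, BT.shape_shape]
        _ = ∑ l₁ ∈ arrangements (Finset.range T.card),
              ∑ l₂ ∈ arrangements (Finset.range (S.card - T.card)),
              f (.node m (treeOf l₁) (treeOf l₂)) := by
            refine ih T.card (by omega) _ rfl
              (fun u => ∑ l₂ ∈ arrangements (Finset.range (S.card - T.card)),
                f (.node m u (treeOf l₂))) fun u => ?_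
            simp only [← BT.apply_node_shape hf m, BT.shape_shape]
        _ = _ := Finset.sum_congr rfl fun _ _ => Finset.sum_congr rfl fun _ _ =>
            (BT.apply_node_shape hf m _ _).symm.trans (BT.apply_node_shape hf 0 _ _)
    intro S hS f hf
    have hne : S.Nonempty := Finset.card_pos.1 (by omega)
    rw [← Finset.insert_erase (S.max'_mem hne),
      key _ _ (fun x hx => S.lt_max'_of_mem_erase_max' hne hx)
        (by rw [Finset.card_erase_of_mem (S.max'_mem hne)]; omega) f hf,
      Finset.range_add_one,
      key (Finset.range n) n (fun x hx => Finset.mem_range.1 hx) (Finset.card_range n) f hf,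
      Finset.range_add_one]

theorem perms_nodup (n : ℕ) : (perms n).Nodup :=
  List.nodup_permutations _ List.nodup_range'

theorem perms_toFinset (n : ℕ) : (perms n).toFinset = arrangements (Finset.Icc 1 n) := by
  ext l
  rw [mem_arrangements, List.mem_toFinset, perms, List.mem_permutations]
  have hIcc : (List.range' 1 n).toFinset = Finset.Icc 1 n := by
    ext x
    simp only [List.mem_toFinset, List.mem_range'_1, Finset.mem_Icc]
    omega
  rw [← hIcc]
  constructor
  · intro h
    exact ⟨h.nodup_iff.2 List.nodup_range', List.toFinset_eq_of_perm _ _ h⟩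
  · rintro ⟨hl, h⟩
    exact List.perm_of_nodup_nodup_toFinset_eq hl List.nodup_range' h

/-- The weight `g u` if `u` is canonical, and `0` otherwise. -/
def canonWeight (g : BT → ℕ) (u : BT) : ℕ := if canonP u then g u else 0

theorem canonWeight_shape {g : BT → ℕ} (hg : ∀ u, g u.shape = g u) (u : BT) :
    canonWeight g u.shape = canonWeight g u := by
  simp only [canonWeight, BT.canonP_shape, hg]

theorem sum_map_pPerms (g : BT → ℕ) (n : ℕ) :
    ((pPerms n).map fun l => g (treeOf l)).sum =
      ∑ l ∈ arrangements (Finset.Icc 1 n), canonWeight g (treeOf l) := by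
  rw [← perms_toFinset]
  simp only [canonWeight]
  rw [List.sum_toFinset _ (perms_nodup n), pPerms]
  induction perms n with
  | nil => rfl
  | cons l L ih => by_cases h : canonP (treeOf l) <;> simp [h, ih]

theorem d_eq_sum (n k : ℕ) :
    d n k = ∑ l ∈ arrangements (Finset.Icc 1 n), canonWeight (countBal k) (treeOf l) :=
  sum_map_pPerms _ n

theorem z_eq_sum (n : ℕ) :
    z n = ∑ l ∈ arrangements (Finset.Icc 1 n), canonWeight (fun _ => 1) (treeOf l) := by
  rw [← sum_map_pPerms]
  simp [z]

theorem t_eq_sum (n k : ℕ) :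
    t n k = ∑ l ∈ arrangements (Finset.Icc 1 n),
      canonWeight (fun u => if balRank u = some k then 1 else 0) (treeOf l) := by
  rw [← sum_map_pPerms, t]
  induction pPerms n with
  | nil => rfl
  | cons l L ih =>
    by_cases h : balRank (treeOf l) = some k <;> simp_all [add_comm]

theorem BT.canonP_node (v : ℕ) (l r : BT) :
    canonP (.node v l r) = (canonP l && canonP r && decide (l = .nil → r = .nil)) := by
  cases l <;> cases r <;> simp [canonP]

theorem canonWeight_countBal_node (k v : ℕ) (l r : BT) :
    canonWeight (countBal k) (.node v l r) +
        (if l = .nil then canonWeight (countBal k) r else 0) =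
      canonWeight (fun u => if balRank u = some k then 1 else 0) (.node v l r) +
        (canonWeight (countBal k) l * canonWeight (fun _ => 1) r +
          canonWeight (fun _ => 1) l * canonWeight (countBal k) r) := by
  simp only [canonWeight, BT.canonP_node, countBal]
  by_cases hl : l = .nil
  · by_cases hr : r = .nil <;> simp [hl, hr, canonP, countBal]
  · cases canonP l <;> cases canonP r <;> simp [hl, add_comm]

theorem treeOf_eq_nil {l : List ℕ} : treeOf l = .nil ↔ l = [] := by
  cases l <;> simp [treeOf, treeOfAux]

theorem sum_powerset_mul {g h : BT → ℕ} (hg : ∀ u, g u.shape = g u)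
    (hh : ∀ u, h u.shape = h u) (n : ℕ) :
    ∑ T ∈ (Finset.Icc 1 n).powerset, ∑ l₁ ∈ arrangements T,
        ∑ l₂ ∈ arrangements (Finset.Icc 1 n \ T), g (treeOf l₁) * h (treeOf l₂) =
      ∑ i ∈ Finset.range (n + 1), n.choose i *
        ((∑ l ∈ arrangements (Finset.Icc 1 i), g (treeOf l)) *
          ∑ l ∈ arrangements (Finset.Icc 1 (n - i)), h (treeOf l)) := by
  have hsum := Finset.sum_powerset_apply_card
    (fun i => (∑ l ∈ arrangements (Finset.Icc 1 i), g (treeOf l)) *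
      ∑ l ∈ arrangements (Finset.Icc 1 (n - i)), h (treeOf l)) (x := Finset.Icc 1 n)
  simp only [Nat.card_Icc, Nat.add_sub_cancel, smul_eq_mul] at hsum
  rw [← hsum]
  refine Finset.sum_congr rfl fun T hT => ?_
  rw [← Finset.sum_mul_sum]
  rw [sum_arrangements_eq_of_card hg (S' := Finset.Icc 1 T.card) (by simp),
    sum_arrangements_eq_of_card hh (S' := Finset.Icc 1 (n - T.card))
      (by simp [Finset.card_sdiff_of_subset (Finset.mem_powerset.1 hT)])]

theorem sum_left_nil (g : BT → ℕ) (S : Finset ℕ) :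
    ∑ T ∈ S.powerset, ∑ l₁ ∈ arrangements T, ∑ l₂ ∈ arrangements (S \ T),
        (if treeOf l₁ = .nil then g (treeOf l₂) else 0) =
      ∑ l ∈ arrangements S, g (treeOf l) := by
  rw [Finset.sum_eq_single ∅]
  · simp [arrangements_empty, treeOf_eq_nil]
  · intro T _ hT
    refine Finset.sum_eq_zero fun l₁ h₁ => Finset.sum_eq_zero fun l₂ _ => if_neg ?_
    rw [treeOf_eq_nil]
    rintro rfl
    exact hT (mem_arrangements.1 h₁).2.symm
  · simp

theorem d_succ_add (k n : ℕ) :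
    d (n + 1) k + d n k =
      t (n + 1) k + 2 * ∑ i ∈ Finset.range (n + 1), n.choose i * z (n - i) * d i k := by
  have hIcc : Finset.Icc 1 (n + 1) = insert (n + 1) (Finset.Icc 1 n) := by
    ext x
    simp only [Finset.mem_insert, Finset.mem_Icc]
    omega
  have hlt : ∀ x ∈ Finset.Icc 1 n, x < n + 1 := fun x hx => by
    rw [Finset.mem_Icc] at hx; omega
  have hd := canonWeight_shape (BT.countBal_shape k)
  have hz := canonWeight_shape (g := fun _ => 1) fun _ => rfl
  rw [d_eq_sum (n + 1), d_eq_sum n, t_eq_sum, hIcc, sum_arrangements_insert_treeOf hlt,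
    sum_arrangements_insert_treeOf hlt, ← sum_left_nil]
  simp only [← Finset.sum_add_distrib, canonWeight_countBal_node]
  simp only [Finset.sum_add_distrib]
  rw [sum_powerset_mul hd hz, sum_powerset_mul hz hd]
  simp only [← d_eq_sum, ← z_eq_sum]
  rw [two_mul]
  congr 2
  · exact Finset.sum_congr rfl fun i _ => by ring
  · rw [← Finset.sum_range_reflect]
    refine Finset.sum_congr rfl fun i hi => ?_
    have hi : i ≤ n := Nat.lt_succ_iff.1 (Finset.mem_range.1 hi)
    rw [show n + 1 - 1 - i = n - i by omega, Nat.choose_symm hi, Nat.sub_sub_self hi, mul_assoc]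

end BalancedTrees

/-- For every fixed `k ≥ 0` and every `n ≥ 0`,
`d(n+1,k) = t(n+1,k) - d(n,k) + 2 * ∑_{i=0}^{n} C(n,i) z(n-i) d(i,k)`,
which is the coefficientwise form of the differential equation
`A_k'(x) = 2 A_k(x) Z(x) - A_k(x) + R_k'(x)` with `A_k(0) = 0`. -/
theorem statement17 (k n : ℕ) :
    (d (n + 1) k : ℤ) =
      t (n + 1) k - d n k +
        2 * ∑ i ∈ Finset.range (n + 1),
          (n.choose i : ℤ) * z (n - i) * d i k := by
  have h := d_succ_add k n
  zify at h
  linarith
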